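/- Assume that g and l are both self-reciprocal. If gcd(r22(x), g11(x)·ḡ11(x) + g12(x)·ḡ12(x)) ≠ 1, then the code C is not Euclidean LCD. -/

import Mathlib

open Polynomial

noncomputable section

/-- The coefficient vector (of length `m`) of the canonical representative of an
element of `R = F[x]/(x^m - 1)`.  Under the identification of `R²` with `F^{2m}` a pair
`(a(x), b(x))` corresponds to the concatenation of the two coefficient vectors. -/
def qcToVec {F : Type} [Field F] {m : ℕ} (hm : 0 < m)
    (a : AdjoinRoot (X ^ m - 1 : F[X])) : Fin m → F := fun i =>
  (AdjoinRoot.modByMonicHom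
    (show (X ^ m - 1 : F[X]).Monic by
      simpa using monic_X_pow_sub_C (1 : F) hm.ne') a).coeff i

/-- The Euclidean inner product `⟨u,v⟩_e = Σ u_i v_i` on `R × R`, via the identification
of `R²` with `F^{2m}` by coefficient vectors. -/
def qcEuclInner {F : Type} [Field F] {m : ℕ} (hm : 0 < m)
    (u v : AdjoinRoot (X ^ m - 1 : F[X]) × AdjoinRoot (X ^ m - 1 : F[X])) : F :=
  (∑ i, qcToVec hm u.1 i * qcToVec hm v.1 i) +
    ∑ i, qcToVec hm u.2 i * qcToVec hm v.2 i

/-- A code `C ⊆ R²` is LCD with respect to a pairing `inner` if it meets its dual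
trivially, i.e. `C ∩ C^⊥ = {0}` where `C^⊥ = {v : ∀ c ∈ C, inner c v = 0}`. -/
def IsLCDWith {F : Type} [Field F] {m : ℕ}
    (Cd : Submodule (AdjoinRoot (X ^ m - 1 : F[X]))
      (AdjoinRoot (X ^ m - 1 : F[X]) × AdjoinRoot (X ^ m - 1 : F[X])))
    (inner : (AdjoinRoot (X ^ m - 1 : F[X]) × AdjoinRoot (X ^ m - 1 : F[X])) →
      (AdjoinRoot (X ^ m - 1 : F[X]) × AdjoinRoot (X ^ m - 1 : F[X])) → F) : Prop :=
  ∀ v ∈ Cd, (∀ c ∈ Cd, inner c v = 0) → v = 0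

/-- `f` is self-reciprocal: the reciprocal polynomial `f*(x) = x^(deg f)·f(1/x)` is a
nonzero scalar multiple of `f`. -/
def IsSelfReciprocal {F : Type} [Field F] (f : F[X]) : Prop :=
  ∃ α : F, α ≠ 0 ∧ f.reverse = Polynomial.C α * f

/-- The image of `f` under the substitution `x ↦ x^(m-1) = x⁻¹` of `F[x]/(x^m - 1)`. -/
def qcConj (F : Type) [Field F] (m : ℕ) : F[X] →ₐ[F] AdjoinRoot (X ^ m - 1 : F[X]) :=
  aeval (AdjoinRoot.root (X ^ m - 1 : F[X]) ^ (m - 1))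

section QuasiCyclic

variable {F : Type} [Field F] {m : ℕ}

lemma qcToVec_add (hm : 0 < m) (a b : AdjoinRoot (X ^ m - 1 : F[X])) (i : Fin m) :
    qcToVec hm (a + b) i = qcToVec hm a i + qcToVec hm b i := by
  simp [qcToVec]

lemma qcToVec_smul (hm : 0 < m) (c : F) (a : AdjoinRoot (X ^ m - 1 : F[X])) (i : Fin m) :
    qcToVec hm (c • a) i = c * qcToVec hm a i := by
  simp [qcToVec]

lemma root_pow_card_eq_one : AdjoinRoot.root (X ^ m - 1 : F[X]) ^ m = 1 := by
  have h := AdjoinRoot.mk_self (f := (X ^ m - 1 : F[X]))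
  rw [map_sub, map_pow, AdjoinRoot.mk_X, map_one, sub_eq_zero] at h
  exact h

lemma qcToVec_root_pow (hm : 0 < m) (n : ℕ) (i : Fin m) :
    qcToVec hm (AdjoinRoot.root (X ^ m - 1 : F[X]) ^ n) i = if (i : ℕ) = n % m then 1 else 0 := by
  have hmon : (X ^ m - 1 : F[X]).Monic := by
    simpa using monic_X_pow_sub_C (1 : F) hm.ne'
  have hdeg : (X ^ m - 1 : F[X]).degree = m := by
    simpa using degree_X_pow_sub_C hm (1 : F)
  rw [pow_eq_pow_mod n (root_pow_card_eq_one (F := F)), ← AdjoinRoot.mk_X, ← map_pow, qcToVec,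
    AdjoinRoot.modByMonicHom_mk, (modByMonic_eq_self_iff hmon).2, coeff_X_pow]
  rw [degree_X_pow, hdeg]
  exact_mod_cast Nat.mod_lt n hm

lemma sum_qcToVec_mul_eq (hm : 0 < m) (f h : F[X]) :
    ∑ i, qcToVec hm (AdjoinRoot.mk (X ^ m - 1 : F[X]) f) i *
        qcToVec hm (AdjoinRoot.mk (X ^ m - 1 : F[X]) h) i =
      qcToVec hm (AdjoinRoot.mk (X ^ m - 1 : F[X]) h * qcConj F m f) ⟨0, hm⟩ := by
  have mk_monomial : ∀ (n : ℕ) (c : F), AdjoinRoot.mk (X ^ m - 1 : F[X]) (monomial n c) =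
      c • AdjoinRoot.root (X ^ m - 1 : F[X]) ^ n := by
    intro n c
    rw [← C_mul_X_pow_eq_monomial, map_mul, map_pow, AdjoinRoot.mk_X, AdjoinRoot.mk_C,
      Algebra.smul_def, AdjoinRoot.algebraMap_eq]
  induction f using Polynomial.induction_on' with
  | add p q hp hq =>
    simp only [map_add, qcToVec_add, add_mul, mul_add, Finset.sum_add_distrib, hp, hq]
  | monomial n c =>
    induction h using Polynomial.induction_on' with
    | add p q hp hq =>
      simp only [map_add, qcToVec_add, add_mul, mul_add, Finset.sum_add_distrib, hp, hq]
    | monomial k d =>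
      have hmod : k % m = n % m ↔ 0 = (k + (m - 1) * n) % m := by
        have hn : (m - 1) * n + n = m * n := by
          rw [← Nat.succ_mul, Nat.succ_eq_add_one, Nat.sub_add_cancel hm]
        constructor
        · intro hkn
          have : 0 + n ≡ (k + (m - 1) * n) + n [MOD m] := by
            have h1 : (k + (m - 1) * n) + n = k + m * n := by omega
            rw [h1, Nat.ModEq, Nat.add_mul_mod_self_left, zero_add, hkn]
          simpa [Nat.ModEq] using Nat.ModEq.add_right_cancel' n this
        · intro h0
          have : 0 + n ≡ (k + (m - 1) * n) + n [MOD m] :=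
            Nat.ModEq.add_right n (by simpa [Nat.ModEq] using h0)
          have h1 : (k + (m - 1) * n) + n = k + m * n := by omega
          rw [h1, Nat.ModEq, Nat.add_mul_mod_self_left, zero_add] at this
          exact this.symm
      rw [qcConj, aeval_monomial, mk_monomial, mk_monomial, ← Algebra.smul_def,
        smul_mul_smul_comm, ← pow_mul, ← pow_add, qcToVec_smul, qcToVec_root_pow,
        Finset.sum_eq_single ⟨n % m, Nat.mod_lt n hm⟩]
      · simp only [qcToVec_smul, qcToVec_root_pow, ← hmod, eq_comm (a := n % m)]
        split_ifs <;> ring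
      · intro i _ hi
        have : (i : ℕ) ≠ n % m := fun h => hi (Fin.ext h)
        simp [qcToVec_smul, qcToVec_root_pow, this]
      · simp

lemma qcConj_eq_mk_reflect (hm : 0 < m) {f : F[X]} (hf : f.natDegree ≤ m) :
    qcConj F m f = AdjoinRoot.mk (X ^ m - 1 : F[X]) (reflect m f) := by
  set ρ := AdjoinRoot.root (X ^ m - 1 : F[X]) with hρ
  have hρm : ρ ^ m = 1 := root_pow_card_eq_one
  have h1 : ρ * ρ ^ (m - 1) = 1 := by rw [← pow_succ', Nat.sub_add_cancel hm, hρm]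
  let _ : Invertible (ρ ^ (m - 1)) := ⟨ρ, h1, by rw [mul_comm, h1]⟩
  have h := eval₂_reflect_mul_pow (AdjoinRoot.of (X ^ m - 1 : F[X])) (ρ ^ (m - 1)) m f hf
  rw [← pow_mul, mul_comm (m - 1) m, pow_mul, hρm, one_pow, mul_one] at h
  rw [← AdjoinRoot.aeval_eq, qcConj, aeval_def, aeval_def, AdjoinRoot.algebraMap_eq]
  exact h.symm

lemma reverse_dvd_reflect {f : F[X]} (hf : f.natDegree ≤ m) : f.reverse ∣ reflect m f := by
  refine ⟨X ^ (m - f.natDegree), ?_⟩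
  have h := reflect_mul f (1 : F[X]) le_rfl (G := m - f.natDegree) (by simp)
  rw [mul_one, Nat.add_sub_cancel' hf, reflect_one] at h
  exact h

/-- A divisor `p` of `x^m - 1` dividing the reflection of `g22`, as well as the self-pairing of the
first generator, but not `g11`, yields the nonzero vector `((x^m - 1)/p)·(g11, g12)` in the hull. -/
lemma not_isLCDWith_of_dvd (hm : 0 < m) {g11 g12 g22 p : F[X]}
    (hd1 : g11.natDegree ≤ m) (hd12 : g12.natDegree ≤ m) (hd2 : g22.natDegree ≤ m)
    (hpm : p ∣ X ^ m - 1) (hp1 : ¬ p ∣ g11) (hp2 : p ∣ reflect m g22)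
    (hpg : p ∣ g11 * reflect m g11 + g12 * reflect m g12) :
    ¬ IsLCDWith
      (Submodule.span (AdjoinRoot (X ^ m - 1 : F[X]))
        {(AdjoinRoot.mk (X ^ m - 1 : F[X]) g11, AdjoinRoot.mk (X ^ m - 1 : F[X]) g12),
          (0, AdjoinRoot.mk (X ^ m - 1 : F[X]) g22)})
      (qcEuclInner hm) := by
  intro hL
  obtain ⟨e, he⟩ := hpm
  have he0 : e ≠ 0 := by
    rintro rfl
    rw [mul_zero] at he
    exact X_pow_sub_C_ne_zero hm (1 : F) (by simpa using he)
  have hkill : ∀ y : F[X], p ∣ y → AdjoinRoot.mk (X ^ m - 1 : F[X]) (e * y) = 0 := by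
    rintro _ ⟨z, rfl⟩
    rw [AdjoinRoot.mk_eq_zero]
    exact ⟨z, by rw [he]; ring⟩
  have hv := hL (AdjoinRoot.mk _ (e * g11), AdjoinRoot.mk _ (e * g12))
    (Submodule.mem_span_pair.2 ⟨AdjoinRoot.mk _ e, 0, by simp⟩) ?_
  · have h0 := congrArg Prod.fst hv
    simp only [Prod.fst_zero] at h0
    rw [AdjoinRoot.mk_eq_zero, he, mul_comm p e] at h0
    exact hp1 ((mul_dvd_mul_iff_left he0).1 h0)
  · intro c hc
    obtain ⟨α, β, rfl⟩ := Submodule.mem_span_pair.1 hc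
    obtain ⟨a, rfl⟩ := AdjoinRoot.mk_surjective α
    obtain ⟨b, rfl⟩ := AdjoinRoot.mk_surjective β
    simp only [qcEuclInner, Prod.smul_mk, Prod.mk_add_mk, smul_eq_mul, mul_zero, add_zero,
      ← map_mul, ← map_add]
    rw [sum_qcToVec_mul_eq, sum_qcToVec_mul_eq, ← qcToVec_add]
    simp only [map_mul (qcConj F m), map_add (qcConj F m), qcConj_eq_mk_reflect hm hd1,
      qcConj_eq_mk_reflect hm hd12, qcConj_eq_mk_reflect hm hd2]
    have hA := hkill _ hpg
    have hB := hkill _ (hp2.mul_left g12)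
    have hzero : AdjoinRoot.mk (X ^ m - 1 : F[X]) (e * g11) *
          (qcConj F m a * AdjoinRoot.mk _ (reflect m g11)) +
        AdjoinRoot.mk _ (e * g12) * (qcConj F m a * AdjoinRoot.mk _ (reflect m g12) +
          qcConj F m b * AdjoinRoot.mk _ (reflect m g22)) = 0 := by
      simp only [map_mul, map_add] at hA hB ⊢
      linear_combination qcConj F m a * hA + qcConj F m b * hB
    rw [hzero]
    simp [qcToVec]

lemma squarefree_X_pow_sub_one [Fintype F] (hqm : Nat.Coprime (Fintype.card F) m) :
    Squarefree (X ^ m - 1 : F[X]) := by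
  have hmF : (m : F) ≠ 0 := by
    intro h0
    obtain ⟨p, hp⟩ := CharP.exists F
    have hpp : p.Prime := CharP.char_is_prime F p
    have h1 : p ∣ m := (CharP.cast_eq_zero_iff F p m).1 h0
    have h2 : p ∣ Fintype.card F := (CharP.cast_eq_zero_iff F p _).1 (FiniteField.cast_card_eq_zero F)
    exact hpp.one_lt.ne' (Nat.dvd_one.1 (hqm ▸ Nat.dvd_gcd h2 h1))
  simpa using (separable_X_pow_sub_C (1 : F) hmF one_ne_zero).squarefree

end QuasiCyclic

/-- Assume `g` and `l` are self-reciprocal.  If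
`gcd(r22, g11·ḡ11 + g12·ḡ12) ≠ 1` then the quasi-cyclic code
`C = ⟨(g11, g12), (0, g22)⟩` is not Euclidean LCD. -/
theorem stmt7 (F : Type) [Field F] [Fintype F] [DecidableEq F] (m : ℕ) (hm : 0 < m)
    (hqm : Nat.Coprime (Fintype.card F) m)
    (g11 g12 g22 : F[X])
    (h1 : g11 ∣ X ^ m - 1) (h2 : g22 ∣ X ^ m - 1)
    (h3 : g12.degree < g22.degree) (h4 : g11 * g22 ∣ (X ^ m - 1) * g12)
    (g l g11' g22' r11 t11 r22 t22 : F[X])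
    (hg : g = gcd g11 g22) (hl : l = (X ^ m - 1) / lcm g11 g22)
    (h11' : g11' = g11 / g) (h22' : g22' = g22 / g)
    (hr11 : r11 = gcd g11' g11'.reverse) (ht11 : t11 = g11' / r11)
    (hr22 : r22 = gcd g22' g22'.reverse) (ht22 : t22 = g22' / r22)
    (hsg : IsSelfReciprocal g) (hsl : IsSelfReciprocal l)
    (hne : ¬ IsCoprime r22 (g11 * reflect m g11 + g12 * reflect m g12)) :
    ¬ IsLCDWith
      (Submodule.span (AdjoinRoot (X ^ m - 1 : F[X]))
        {(AdjoinRoot.mk (X ^ m - 1 : F[X]) g11, AdjoinRoot.mk (X ^ m - 1 : F[X]) g12), (0, AdjoinRoot.mk (X ^ m - 1 : F[X]) g22)})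
      (qcEuclInner hm) := by
  have hX0 : (X ^ m - 1 : F[X]) ≠ 0 := by simpa using X_pow_sub_C_ne_zero hm (1 : F)
  have hXd : (X ^ m - 1 : F[X]).natDegree = m := by
    simpa using natDegree_X_pow_sub_C (n := m) (r := (1 : F))
  have hg22 : g22 ≠ 0 := ne_zero_of_dvd_ne_zero hX0 h2
  have hd1 : g11.natDegree ≤ m := hXd ▸ natDegree_le_of_dvd h1 hX0
  have hd2 : g22.natDegree ≤ m := hXd ▸ natDegree_le_of_dvd h2 hX0
  have hd12 : g12.natDegree ≤ m := (natDegree_le_natDegree h3.le).trans hd2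
  have hgd : g ∣ g22 := hg ▸ gcd_dvd_right g11 g22
  have hfac : g22 = g * g22' := by
    rw [h22']
    exact (EuclideanDomain.mul_div_cancel' (ne_zero_of_dvd_ne_zero hg22 hgd) hgd).symm
  have hg22' : g22' ≠ 0 := right_ne_zero_of_mul (hfac ▸ hg22)
  have hrd : r22 ∣ g22' := hr22 ▸ gcd_dvd_left _ _
  have hrd' : r22 ∣ g22'.reverse := hr22 ▸ gcd_dvd_right _ _
  obtain ⟨p, hp, hpr, hps⟩ : ∃ p, Prime p ∧ p ∣ r22 ∧
      p ∣ g11 * reflect m g11 + g12 * reflect m g12 := by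
    by_contra! hno
    exact hne (isCoprime_of_prime_dvd (fun h => ne_zero_of_dvd_ne_zero hg22' hrd h.1) hno)
  have hp22' : p ∣ g22' := hpr.trans hrd
  have hp22 : p ∣ g22 := hfac ▸ hp22'.mul_left g
  refine not_isLCDWith_of_dvd hm hd1 hd12 hd2 (hp22.trans h2) (fun hp11 => ?_) ?_ hps
  · have hpg : p ∣ g := hg ▸ dvd_gcd hp11 hp22
    have hpp : p * p ∣ X ^ m - 1 := (mul_dvd_mul hpg hp22').trans (hfac ▸ h2)
    exact hp.not_isUnit (squarefree_X_pow_sub_one hqm p hpp)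
  · refine (hpr.trans hrd').trans (dvd_trans ?_ (reverse_dvd_reflect hd2))
    rw [hfac, reverse_mul_of_domain]
    exact dvd_mul_left _ _
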